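/- For λ < 0, as x → ∞, 1 - F_λ(x) = e^{-(1+λ²)x²/2} / (-πλ(1+λ²)x²) · [1 - ((1+3λ²)/(λ²(1+λ²))) x^{-2} + O(x^{-4})]. -/

import Mathlib

open Real MeasureTheory Filter

noncomputable def stdPhi (x : ℝ) : ℝ := (Real.sqrt (2 * Real.pi))⁻¹ * Real.exp (-x ^ 2 / 2)

noncomputable def stdCdf (x : ℝ) : ℝ := ∫ t in Set.Iic x, stdPhi t

noncomputable def snCdf (l x : ℝ) : ℝ := ∫ t in Set.Iic x, 2 * stdPhi t * stdCdf (l * t)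

open Topology in
theorem nonneg_of_hasDerivAt_nonpos_of_tendsto_zero {g g' : ℝ → ℝ}
    (hg : ∀ x, 0 < x → HasDerivAt g (g' x) x) (hg' : ∀ x, 0 < x → g' x ≤ 0)
    (hlim : Tendsto g atTop (𝓝 0)) {x : ℝ} (hx : 0 < x) : 0 ≤ g x := by
  have hanti : AntitoneOn g (Set.Ioi 0) := by
    refine antitoneOn_of_deriv_nonpos (convex_Ioi 0)
      (fun y hy => (hg y hy).continuousAt.continuousWithinAt) ?_ ?_
    · intro y hy
      rw [interior_Ioi] at hy
      exact (hg y hy).differentiableAt.differentiableWithinAt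
    · intro y hy
      rw [interior_Ioi] at hy
      rw [(hg y hy).deriv]
      exact hg' y hy
  refine le_of_tendsto hlim ?_
  filter_upwards [eventually_ge_atTop x] with y hy
  exact hanti hx (hx.trans_le hy) hy

theorem hasDerivAt_exp_mul_inv_pow (c : ℝ) (n : ℕ) {x : ℝ} (hx : 0 < x) :
    HasDerivAt (fun y : ℝ => Real.exp (-c * y ^ 2 / 2) * y⁻¹ ^ (n + 1))
      (-(Real.exp (-c * x ^ 2 / 2) * (c * x⁻¹ ^ n + (n + 1) * x⁻¹ ^ (n + 2)))) x := by
  have hexp : HasDerivAt (fun y : ℝ => Real.exp (-c * y ^ 2 / 2))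
      (Real.exp (-c * x ^ 2 / 2) * (-c * (2 * x) / 2)) x := by
    have h := (((hasDerivAt_pow 2 x).const_mul (-c)).div_const 2).exp
    simpa using h
  have hinv : HasDerivAt (fun y : ℝ => y⁻¹ ^ (n + 1))
      ((n + 1) * x⁻¹ ^ n * (-(x ^ 2)⁻¹)) x := by
    have h := (hasDerivAt_inv hx.ne').fun_pow (n + 1)
    simpa using h
  refine (hexp.mul hinv).congr_deriv ?_
  have hx' := hx.ne'
  rw [← inv_pow, pow_succ x⁻¹ n]
  linear_combination (-(c * Real.exp (-c * x ^ 2 / 2) * x⁻¹ ^ n)) * mul_inv_cancel₀ hx'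

open Topology in
theorem tendsto_exp_mul_inv_pow {c : ℝ} (hc : 0 < c) (n : ℕ) :
    Tendsto (fun y : ℝ => Real.exp (-c * y ^ 2 / 2) * y⁻¹ ^ (n + 1)) atTop (𝓝 0) := by
  have hinv : Tendsto (fun y : ℝ => y⁻¹ ^ (n + 1)) atTop (𝓝 0) := by
    simpa using (tendsto_inv_atTop_zero (𝕜 := ℝ)).pow (n + 1)
  refine squeeze_zero' ?_ ?_ hinv
  · filter_upwards [eventually_gt_atTop 0] with y hy
    positivity
  · filter_upwards [eventually_gt_atTop 0] with y hy
    refine mul_le_of_le_one_left (by positivity) (Real.exp_le_one_iff.2 ?_)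
    have : 0 ≤ c * y ^ 2 := by positivity
    linarith

theorem hasDerivAt_setIntegral_Iic {f : ℝ → ℝ} (hf : Continuous f) (hfi : Integrable f) (x : ℝ) :
    HasDerivAt (fun y => ∫ t in Set.Iic y, f t) (f x) x := by
  have h : HasDerivAt (fun y => ∫ t in (0 : ℝ)..y, f t) (f x) x :=
    intervalIntegral.integral_hasDerivAt_right (hf.intervalIntegrable _ _)
      (hf.stronglyMeasurableAtFilter _ _) hf.continuousAt
  have heq : (fun y => ∫ t in Set.Iic y, f t) =
      fun y => (∫ t in (0 : ℝ)..y, f t) + ∫ t in Set.Iic (0 : ℝ), f t := by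
    funext y
    rw [← intervalIntegral.integral_Iic_sub_Iic hfi.integrableOn hfi.integrableOn]
    ring
  rw [heq]
  exact h.add_const _

open Topology in
theorem tendsto_setIntegral_Iic_atTop {f : ℝ → ℝ} (hfi : Integrable f) :
    Tendsto (fun y => ∫ t in Set.Iic y, f t) atTop (𝓝 (∫ t, f t)) :=
  (aecover_Iic tendsto_id).integral_tendsto_of_countably_generated hfi

theorem stdPhi_eq (x : ℝ) :
    stdPhi x = (Real.sqrt (2 * Real.pi))⁻¹ * Real.exp (-1 * x ^ 2 / 2) := by
  simp [stdPhi]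

theorem stdPhi_nonneg (x : ℝ) : 0 ≤ stdPhi x := by
  unfold stdPhi
  positivity

theorem stdPhi_neg (x : ℝ) : stdPhi (-x) = stdPhi x := by
  simp [stdPhi]

theorem continuous_stdPhi : Continuous stdPhi := by
  unfold stdPhi
  fun_prop

theorem stdPhi_eq_gaussianPDFReal : stdPhi = ProbabilityTheory.gaussianPDFReal 0 1 := by
  funext x
  simp [stdPhi, ProbabilityTheory.gaussianPDFReal]

theorem integrable_stdPhi : Integrable stdPhi := by
  rw [stdPhi_eq_gaussianPDFReal]
  exact ProbabilityTheory.integrable_gaussianPDFReal 0 1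

theorem integral_stdPhi : ∫ t, stdPhi t = 1 := by
  rw [stdPhi_eq_gaussianPDFReal]
  exact ProbabilityTheory.integral_gaussianPDFReal_eq_one 0 one_ne_zero

theorem stdCdf_neg (x : ℝ) : stdCdf (-x) = 1 - stdCdf x := by
  have h := integral_comp_neg_Iic (-x) stdPhi
  simp only [stdPhi_neg, neg_neg] at h
  have h2 := intervalIntegral.integral_Iic_add_Ioi (b := x) integrable_stdPhi.integrableOn
    integrable_stdPhi.integrableOn
  rw [integral_stdPhi] at h2
  unfold stdCdf
  linarith

theorem hasDerivAt_stdCdf (x : ℝ) : HasDerivAt stdCdf (stdPhi x) x :=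
  hasDerivAt_setIntegral_Iic continuous_stdPhi integrable_stdPhi x

theorem continuous_stdCdf : Continuous stdCdf :=
  continuous_iff_continuousAt.2 fun x => (hasDerivAt_stdCdf x).continuousAt

theorem stdCdf_nonneg (x : ℝ) : 0 ≤ stdCdf x :=
  setIntegral_nonneg measurableSet_Iic fun t _ => stdPhi_nonneg t

theorem stdCdf_le_one (x : ℝ) : stdCdf x ≤ 1 := by
  have h := stdCdf_nonneg (-x)
  rw [stdCdf_neg] at h
  linarith

open Topology in
theorem tendsto_stdCdf_neg : Tendsto (fun x => stdCdf (-x)) atTop (𝓝 0) := by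
  simp only [stdCdf_neg]
  have h := tendsto_setIntegral_Iic_atTop integrable_stdPhi
  rw [integral_stdPhi] at h
  simpa [stdCdf] using h.const_sub 1

theorem hasDerivAt_stdCdf_neg (x : ℝ) : HasDerivAt (fun y => stdCdf (-y)) (-stdPhi x) x := by
  simp only [stdCdf_neg]
  exact (hasDerivAt_stdCdf x).const_sub 1

/-- Second-order lower bound for the Gaussian tail. -/
theorem le_stdCdf_neg {x : ℝ} (hx : 0 < x) :
    stdPhi x * (x⁻¹ - x⁻¹ ^ 3) ≤ stdCdf (-x) := by
  have key := nonneg_of_hasDerivAt_nonpos_of_tendsto_zero (fun y hy =>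
      (hasDerivAt_stdCdf_neg y).fun_sub (((hasDerivAt_exp_mul_inv_pow 1 0 hy).fun_sub
        (hasDerivAt_exp_mul_inv_pow 1 2 hy)).const_mul (Real.sqrt (2 * Real.pi))⁻¹)) ?_ ?_ hx
  · rw [stdPhi_eq]
    linear_combination key
  · intro y hy
    rw [stdPhi_eq]
    have : 0 ≤ (Real.sqrt (2 * Real.pi))⁻¹ * Real.exp (-1 * y ^ 2 / 2) * y⁻¹ ^ 4 := by positivity
    push_cast
    linear_combination 3 * this
  · simpa using tendsto_stdCdf_neg.sub (((tendsto_exp_mul_inv_pow one_pos 0).sub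
      (tendsto_exp_mul_inv_pow one_pos 2)).const_mul (Real.sqrt (2 * Real.pi))⁻¹)

/-- Third-order upper bound for the Gaussian tail. -/
theorem stdCdf_neg_le {x : ℝ} (hx : 0 < x) :
    stdCdf (-x) ≤ stdPhi x * (x⁻¹ - x⁻¹ ^ 3 + 3 * x⁻¹ ^ 5) := by
  have key := nonneg_of_hasDerivAt_nonpos_of_tendsto_zero (fun y hy =>
      ((((hasDerivAt_exp_mul_inv_pow 1 0 hy).fun_sub (hasDerivAt_exp_mul_inv_pow 1 2 hy)).fun_add
        ((hasDerivAt_exp_mul_inv_pow 1 4 hy).const_mul 3)).const_mul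
          (Real.sqrt (2 * Real.pi))⁻¹).fun_sub (hasDerivAt_stdCdf_neg y)) ?_ ?_ hx
  · rw [stdPhi_eq]
    linear_combination key
  · intro y hy
    rw [stdPhi_eq]
    have : 0 ≤ (Real.sqrt (2 * Real.pi))⁻¹ * Real.exp (-1 * y ^ 2 / 2) * y⁻¹ ^ 6 := by positivity
    push_cast
    linear_combination 15 * this
  · simpa using ((((tendsto_exp_mul_inv_pow one_pos 0).sub
      (tendsto_exp_mul_inv_pow one_pos 2)).add
        ((tendsto_exp_mul_inv_pow one_pos 4).const_mul 3)).const_mul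
          (Real.sqrt (2 * Real.pi))⁻¹).sub tendsto_stdCdf_neg

theorem continuous_skewNormal_density (l : ℝ) :
    Continuous fun t => 2 * stdPhi t * stdCdf (l * t) :=
  (continuous_const.mul continuous_stdPhi).mul
    (continuous_stdCdf.comp (continuous_const.mul continuous_id))

theorem integrable_skewNormal_density (l : ℝ) :
    Integrable fun t => 2 * stdPhi t * stdCdf (l * t) := by
  refine (integrable_stdPhi.const_mul 2).mono'
    (continuous_skewNormal_density l).aestronglyMeasurable (ae_of_all _ fun t => ?_)
  have h := stdPhi_nonneg t
  have h0 := stdCdf_nonneg (l * t)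
  rw [Real.norm_of_nonneg (by positivity)]
  exact mul_le_of_le_one_right (by positivity) (stdCdf_le_one _)

theorem integral_skewNormal_density (l : ℝ) :
    ∫ t, 2 * stdPhi t * stdCdf (l * t) = 1 := by
  have hi := integrable_skewNormal_density l
  have h := integral_neg_eq_self (fun t => 2 * stdPhi t * stdCdf (l * t)) volume
  simp only [stdPhi_neg, mul_neg, stdCdf_neg, mul_sub, mul_one] at h
  rw [integral_sub (integrable_stdPhi.const_mul 2) hi, integral_const_mul, integral_stdPhi] at h
  linarith

theorem hasDerivAt_snCdf (l x : ℝ) :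
    HasDerivAt (snCdf l) (2 * stdPhi x * stdCdf (l * x)) x :=
  hasDerivAt_setIntegral_Iic (continuous_skewNormal_density l) (integrable_skewNormal_density l) x

open Topology in
theorem tendsto_one_sub_snCdf (l : ℝ) : Tendsto (fun x => 1 - snCdf l x) atTop (𝓝 0) := by
  have h := tendsto_setIntegral_Iic_atTop (integrable_skewNormal_density l)
  rw [integral_skewNormal_density] at h
  simpa [snCdf] using h.const_sub 1

theorem two_mul_stdPhi_mul_stdPhi (l x : ℝ) :
    2 * stdPhi x * stdPhi (l * x) = Real.pi⁻¹ * Real.exp (-(1 + l ^ 2) * x ^ 2 / 2) := by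
  have hexp : Real.exp (-(1 + l ^ 2) * x ^ 2 / 2) =
      Real.exp (-x ^ 2 / 2) * Real.exp (-(l * x) ^ 2 / 2) := by
    rw [← Real.exp_add]
    ring_nf
  have hsq : 2 * ((Real.sqrt (2 * Real.pi))⁻¹ * (Real.sqrt (2 * Real.pi))⁻¹) = Real.pi⁻¹ := by
    rw [← mul_inv, Real.mul_self_sqrt (by positivity)]
    field_simp
  rw [hexp, ← hsq]
  unfold stdPhi
  ring

theorem skewNormal_density_bounds {s x : ℝ} (hs : 0 < s) (hx : 0 < x) :
    Real.exp (-(1 + s ^ 2) * x ^ 2 / 2) * (Real.pi⁻¹ * s⁻¹) * (x⁻¹ - s⁻¹ ^ 2 * x⁻¹ ^ 3) ≤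
        2 * stdPhi x * stdCdf (-s * x) ∧
      2 * stdPhi x * stdCdf (-s * x) ≤
        Real.exp (-(1 + s ^ 2) * x ^ 2 / 2) * (Real.pi⁻¹ * s⁻¹) *
          (x⁻¹ - s⁻¹ ^ 2 * x⁻¹ ^ 3 + 3 * s⁻¹ ^ 4 * x⁻¹ ^ 5) := by
  have hsx : 0 < s * x := by positivity
  have hφ : 0 ≤ 2 * stdPhi x := mul_nonneg zero_le_two (stdPhi_nonneg x)
  have hlow := mul_le_mul_of_nonneg_left (le_stdCdf_neg hsx) hφ
  have hup := mul_le_mul_of_nonneg_left (stdCdf_neg_le hsx) hφ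
  rw [← mul_assoc, two_mul_stdPhi_mul_stdPhi, mul_inv] at hlow hup
  rw [neg_mul s x]
  constructor
  · linear_combination hlow
  · linear_combination hup

theorem abs_skewNormal_tail_sub_le {s x : ℝ} (hs : 0 < s) (hx : 0 < x) :
    |1 - snCdf (-s) x - Real.pi⁻¹ * s⁻¹ * (1 + s ^ 2)⁻¹ *
        (Real.exp (-(1 + s ^ 2) * x ^ 2 / 2) * x⁻¹ ^ 2 -
          (2 * (1 + s ^ 2)⁻¹ + s⁻¹ ^ 2) *
            (Real.exp (-(1 + s ^ 2) * x ^ 2 / 2) * x⁻¹ ^ 4))| ≤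
      (3 * s⁻¹ ^ 4 + 4 * (2 * (1 + s ^ 2)⁻¹ + s⁻¹ ^ 2) * (1 + s ^ 2)⁻¹) *
        (Real.pi⁻¹ * s⁻¹ * (1 + s ^ 2)⁻¹ *
          (Real.exp (-(1 + s ^ 2) * x ^ 2 / 2) * x⁻¹ ^ 6)) := by
  have hc : 0 < 1 + s ^ 2 := by positivity
  have hcinv : (1 + s ^ 2) * (1 + s ^ 2)⁻¹ = 1 := mul_inv_cancel₀ hc.ne'
  set c := 1 + s ^ 2
  set d := c⁻¹
  have hd : 0 < d := inv_pos.2 hc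
  set k := 2 * d + s⁻¹ ^ 2 with hk
  have hkpos : 0 < k := by positivity
  set K := 3 * s⁻¹ ^ 4 + 4 * k * d with hK
  set A := Real.pi⁻¹ * s⁻¹ with hA
  have hApos : 0 < A := by positivity
  have hdiff : ∀ y, 0 < y → HasDerivAt (fun y => 1 - snCdf (-s) y - A * d *
      (Real.exp (-c * y ^ 2 / 2) * y⁻¹ ^ 2 - k * (Real.exp (-c * y ^ 2 / 2) * y⁻¹ ^ 4))) _ y :=
    fun y hy => ((hasDerivAt_snCdf (-s) y).const_sub 1).sub
      (((hasDerivAt_exp_mul_inv_pow c 1 hy).sub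
        ((hasDerivAt_exp_mul_inv_pow c 3 hy).const_mul k)).const_mul (A * d))
  have hrem : ∀ y, 0 < y → HasDerivAt (fun y => K * (A * d *
      (Real.exp (-c * y ^ 2 / 2) * y⁻¹ ^ 6))) _ y :=
    fun y hy => ((hasDerivAt_exp_mul_inv_pow c 5 hy).const_mul (A * d)).const_mul K
  have hdifflim := (tendsto_one_sub_snCdf (-s)).sub
    (((tendsto_exp_mul_inv_pow hc 1).sub
      ((tendsto_exp_mul_inv_pow hc 3).const_mul k)).const_mul (A * d))
  have hremlim := ((tendsto_exp_mul_inv_pow hc 5).const_mul (A * d)).const_mul K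
  rw [abs_le]
  constructor
  · have key := nonneg_of_hasDerivAt_nonpos_of_tendsto_zero
      (fun y hy => (hdiff y hy).fun_add (hrem y hy)) ?_ (by simpa using hdifflim.add hremlim) hx
    · linarith
    · intro y hy
      obtain ⟨hlow, -⟩ := skewNormal_density_bounds hs hy
      set E := Real.exp (-c * y ^ 2 / 2)
      have h7 : 0 ≤ K * A * d * E * y⁻¹ ^ 7 := by positivity
      have hs4 : 0 ≤ E * A * y⁻¹ ^ 5 * s⁻¹ ^ 4 := by positivity
      have hkd : 0 ≤ E * A * y⁻¹ ^ 5 * (k * d) := by positivity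
      push_cast
      linear_combination hlow + 6 * h7 + 8 * hkd + 3 * hs4 +
        A * E * (y⁻¹ - k * y⁻¹ ^ 3 - K * y⁻¹ ^ 5) * hcinv - A * E * y⁻¹ ^ 3 * hk -
        A * E * y⁻¹ ^ 5 * hK
  · have key := nonneg_of_hasDerivAt_nonpos_of_tendsto_zero
      (fun y hy => (hrem y hy).fun_sub (hdiff y hy)) ?_ (by simpa using hremlim.sub hdifflim) hx
    · linarith
    · intro y hy
      obtain ⟨-, hup⟩ := skewNormal_density_bounds hs hy
      set E := Real.exp (-c * y ^ 2 / 2)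
      have h7 : 0 ≤ K * A * d * E * y⁻¹ ^ 7 := by positivity
      push_cast
      linear_combination hup + 6 * h7 -
        A * E * (y⁻¹ - k * y⁻¹ ^ 3 + K * y⁻¹ ^ 5) * hcinv + A * E * y⁻¹ ^ 3 * hk -
        A * E * y⁻¹ ^ 5 * hK

theorem stmt_6 (l : ℝ) (hl : l < 0) :
    (fun x : ℝ => 1 - snCdf l x -
        Real.exp (-(1 + l ^ 2) * x ^ 2 / 2) / (-Real.pi * l * (1 + l ^ 2) * x ^ 2) *
          (1 - (1 + 3 * l ^ 2) / (l ^ 2 * (1 + l ^ 2)) * x⁻¹ ^ 2)) =O[atTop]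
      (fun x : ℝ =>
        Real.exp (-(1 + l ^ 2) * x ^ 2 / 2) / (-Real.pi * l * (1 + l ^ 2) * x ^ 2) * x⁻¹ ^ 4) := by
  obtain ⟨s, rfl⟩ : ∃ s, l = -s := ⟨-l, by ring⟩
  have hs : 0 < s := by linarith
  refine Asymptotics.IsBigO.of_bound
    (3 * s⁻¹ ^ 4 + 4 * (2 * (1 + s ^ 2)⁻¹ + s⁻¹ ^ 2) * (1 + s ^ 2)⁻¹) ?_
  filter_upwards [eventually_gt_atTop 0] with x hx
  rw [neg_sq]
  have hrem : Real.exp (-(1 + s ^ 2) * x ^ 2 / 2) / (-Real.pi * -s * (1 + s ^ 2) * x ^ 2) *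
      x⁻¹ ^ 4 = Real.pi⁻¹ * s⁻¹ * (1 + s ^ 2)⁻¹ *
          (Real.exp (-(1 + s ^ 2) * x ^ 2 / 2) * x⁻¹ ^ 6) := by
    field_simp
  have hmain : Real.exp (-(1 + s ^ 2) * x ^ 2 / 2) / (-Real.pi * -s * (1 + s ^ 2) * x ^ 2) *
      (1 - (1 + 3 * s ^ 2) / (s ^ 2 * (1 + s ^ 2)) * x⁻¹ ^ 2) =
      Real.pi⁻¹ * s⁻¹ * (1 + s ^ 2)⁻¹ *
        (Real.exp (-(1 + s ^ 2) * x ^ 2 / 2) * x⁻¹ ^ 2 -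
          (2 * (1 + s ^ 2)⁻¹ + s⁻¹ ^ 2) *
            (Real.exp (-(1 + s ^ 2) * x ^ 2 / 2) * x⁻¹ ^ 4)) := by
    field_simp
    ring
  rw [hrem, hmain, Real.norm_eq_abs, Real.norm_of_nonneg (by positivity)]
  exact abs_skewNormal_tail_sub_le hs hx
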